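/- Let I and X be disjoint sets of edges of the complete graph on V, let H be a Hamiltonian cycle on V whose edge set contains every edge of I and no edge of X, and let v ∈ V. Then the minimum weight over all spanning trees of the complete graph on V \ {v} whose edge set contains every edge of I not incident with v and contains no edge of X is at most the sum of the weights of the edges of H not incident with v. -/

import Mathlib

open SimpleGraph Finset

variable {V : Type} [Fintype V] [DecidableEq V]

/-- `S` is the edge set of a spanning tree of the complete graph on `V \ {v}`:
the edges of a tree on the subtype `{u // u ≠ v}`, viewed inside `Sym2 V`. -/
def IsSpanningTreeOff (v : V) (S : Finset (Sym2 V)) : Prop :=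
  ∃ T : SimpleGraph {u : V // u ≠ v}, T.IsTree ∧
    (S : Set (Sym2 V)) = Sym2.map Subtype.val '' T.edgeSet

/-- `T` is (the edge set of) a 1-tree rooted at `v`: a spanning tree of the complete
graph on `V \ {v}` together with two distinct (non-loop) edges incident with `v`. -/
def IsOneTree (v : V) (T : Finset (Sym2 V)) : Prop :=
  ∃ (S : Finset (Sym2 V)) (e₁ e₂ : Sym2 V),
    IsSpanningTreeOff v S ∧ e₁ ≠ e₂ ∧ v ∈ e₁ ∧ v ∈ e₂ ∧
    ¬ e₁.IsDiag ∧ ¬ e₂.IsDiag ∧ T = S ∪ {e₁, e₂}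

/-- The total weight of an edge set. -/
noncomputable def weight (w : Sym2 V → ℝ) (T : Finset (Sym2 V)) : ℝ := ∑ e ∈ T, w e

/-- The graph whose edges are those of a walk `p` has exactly the edges of `p`. -/
theorem SimpleGraph.Walk.edgeSet_fromEdgeSet_edges {α : Type*} {G : SimpleGraph α} {a b : α}
    (p : G.Walk a b) : (fromEdgeSet {e | e ∈ p.edges}).edgeSet = {e | e ∈ p.edges} := by
  rw [edgeSet_fromEdgeSet, sdiff_eq_left]
  exact Set.disjoint_left.2 fun e he hd =>
    G.not_isDiag_of_mem_edgeSet (p.edges_subset_edgeSet he) hd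

/-- The edges of a Hamiltonian path form a tree. -/
theorem SimpleGraph.Walk.IsHamiltonian.isTree_fromEdgeSet {α : Type*} [Fintype α] [DecidableEq α]
    {G : SimpleGraph α} {a b : α} {p : G.Walk a b} (hp : p.IsHamiltonian) :
    (fromEdgeSet {e | e ∈ p.edges}).IsTree := by
  have hedge := p.edgeSet_fromEdgeSet_edges
  rw [isTree_iff_connected_and_card]
  constructor
  · rw [connected_iff_exists_forall_reachable]
    refine ⟨a, fun c => ?_⟩
    have hc : c ∈ (p.transfer (fromEdgeSet {e | e ∈ p.edges}) fun e he => by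
        rw [hedge]; exact he).support := by
      rw [Walk.support_transfer]
      exact hp.mem_support c
    exact ⟨Walk.takeUntil _ c hc⟩
  · rw [hedge]
    have hset : {e | e ∈ p.edges} = (p.edges.toFinset : Set (Sym2 α)) := by ext; simp
    rw [hset, Nat.card_coe_set_eq, Set.ncard_coe_finset,
      List.toFinset_card_of_nodup hp.isPath.isTrail.edges_nodup, Walk.length_edges, hp.length_eq,
      Nat.card_eq_fintype_card]
    exact Nat.sub_add_cancel (Fintype.card_pos_iff.2 ⟨a⟩)

/-- Deleting the base vertex of a Hamiltonian cycle leaves a path through all other vertices. -/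
theorem SimpleGraph.Walk.IsHamiltonianCycle.exists_isPath_off {α : Type*} [DecidableEq α]
    {G : SimpleGraph α} {v : α} {C : G.Walk v v} (hC : C.IsHamiltonianCycle) :
    ∃ (a b : α) (p : G.Walk a b), p.IsPath ∧ (∀ u, u ∈ p.support ↔ u ≠ v) ∧
      ∀ e, e ∈ p.edges ↔ e ∈ C.edges ∧ v ∉ e := by
  cases C with
  | nil => exact absurd rfl hC.ne_nil
  | cons h q =>
    rename_i a
    have hq : q.IsHamiltonian := by simpa [Walk.IsHamiltonian] using hC.isHamiltonian_tail
    obtain ⟨b, p, h', rfl⟩ : ∃ (b : α) (p : G.Walk a b) (h' : G.Adj b v), q = p.concat h' := by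
      cases q with
      | nil => exact absurd rfl h.ne
      | cons h₁ q => exact Walk.exists_cons_eq_concat h₁ q
    have hpath := hq.isPath
    rw [Walk.concat_isPath_iff] at hpath
    refine ⟨a, b, p, hpath.1, fun u => ⟨?_, fun hu => ?_⟩, fun e => ⟨fun he => ?_, ?_⟩⟩
    · rintro hu rfl
      exact hpath.2 hu
    · simpa [Walk.support_concat, hu] using hq.mem_support u
    · exact ⟨by simp [Walk.edges_concat, he],
        fun hv => hpath.2 (p.mem_support_of_mem_edges he hv)⟩
    · rintro ⟨he, hv⟩
      rw [Walk.edges_cons, Walk.edges_concat] at he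
      simp only [List.mem_cons, List.concat_eq_append, List.mem_append, List.not_mem_nil,
        or_false] at he
      rcases he with rfl | he | rfl
      · simp at hv
      · exact he
      · simp at hv

/-- The edges of a Hamiltonian cycle that avoid `v` form a spanning tree off `v`. -/
theorem SimpleGraph.Walk.IsHamiltonianCycle.isSpanningTreeOff {α : Type} [Fintype α]
    [DecidableEq α] {G : SimpleGraph α} {r : α} {C : G.Walk r r} (hC : C.IsHamiltonianCycle)
    (v : α) : IsSpanningTreeOff v (C.edges.toFinset.filter (fun e => v ∉ e)) := by
  have hv := hC.mem_support v
  obtain ⟨a, b, p, hp, hsupp, hedges⟩ := (hC.rotate hv).exists_isPath_off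
  let q := p.induce {u | u ≠ v} fun u hu => (hsupp u).1 hu
  have hmap : q.map (Embedding.induce _).toHom = p := p.map_induce _
  have hq : q.IsHamiltonian := by
    refine Walk.IsPath.isHamiltonian_of_mem (Walk.IsPath.of_map (hmap ▸ hp)) fun u => ?_
    rw [Walk.support_induce]
    simpa using (hsupp u).2 u.2
  refine ⟨fromEdgeSet {e | e ∈ q.edges}, hq.isTree_fromEdgeSet, ?_⟩
  have hmem : ∀ e, e ∈ p.edges ↔ ∃ f ∈ q.edges, Sym2.map Subtype.val f = e := by
    intro e
    have hedges_map : q.edges.map (Sym2.map (Embedding.induce (G := G) {u | u ≠ v}).toHom) =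
        p.edges :=
      (q.edges_map _).symm.trans (congrArg Walk.edges hmap)
    rw [← hedges_map, List.mem_map]
    rfl
  refine Eq.trans ?_ (congrArg (Sym2.map Subtype.val '' ·) q.edgeSet_fromEdgeSet_edges.symm)
  ext e
  rw [Set.mem_image]
  refine Iff.trans ?_ (hmem e)
  rw [hedges, (C.rotate_edges v hv).mem_iff]
  simp

theorem stmt3 {V : Type} [Fintype V] [DecidableEq V] (h3 : 3 ≤ Fintype.card V)
    (w : Sym2 V → ℝ) (I X : Finset (Sym2 V))
    (hIedge : (I : Set (Sym2 V)) ⊆ (⊤ : SimpleGraph V).edgeSet)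
    (hXedge : (X : Set (Sym2 V)) ⊆ (⊤ : SimpleGraph V).edgeSet)
    (hIX : Disjoint I X)
    (r : V) (H : (⊤ : SimpleGraph V).Walk r r) (hH : H.IsHamiltonianCycle)
    (hIH : I ⊆ H.edges.toFinset) (hXH : ∀ e ∈ X, e ∉ H.edges.toFinset) (v : V) :
    sInf {x : ℝ | ∃ T : Finset (Sym2 V), IsSpanningTreeOff v T ∧
        (∀ e ∈ I, v ∉ e → e ∈ T) ∧ (∀ e ∈ X, e ∉ T) ∧ weight w T = x}
      ≤ weight w (H.edges.toFinset.filter (fun e => v ∉ e)) := by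
  refine csInf_le ?_ ⟨_, hH.isSpanningTreeOff v, fun e he hv => ?_, fun e he heT => ?_, rfl⟩
  · refine ((Set.finite_range (weight w)).subset ?_).bddBelow
    rintro x ⟨T, -, -, -, rfl⟩
    exact ⟨T, rfl⟩
  · exact Finset.mem_filter.2 ⟨hIH he, hv⟩
  · exact hXH e he (Finset.mem_filter.1 heT).1
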